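/- arXiv:1006.1334 — 2 statements merged into one kernel-verified Lean document; each statement's English description precedes it below -/
import Mathlib

section
/- Let T be a smooth Lie solution of the mass transport equation (a cost exponential of a locally exact 1-form satisfying T*ρ̄ = ρ), define λ = (ρ(x) ρ̄(T(x)) / det b(x,T(x)))^{1/(n−2)} for n ≥ 3, g = λ w with w the pulled-back Kim–McCann metric, and θ = log det w − log ρ + log(ρ̄∘T) − log det b. Then the linearized optimal-transport operator L satisfies L z = λ ( Δ_g z + (1/2) ⟨∇θ, ∇z⟩_g ), where L z = w^{ij} z_{ij} − w^{ij} b_{ij s̄} b^{s̄ k} z_k − b^{s̄ i} b_{s̄ i p̄} b^{p̄ k} z_k + (log ρ̄)_{s̄} b^{s̄ k} z_k. -/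
noncomputable section

abbrev ee {n : ℕ} (i : Fin n) : Fin n → ℝ := Pi.single i 1

/-- Partial derivative `∂_i f`. -/
def pd {n : ℕ} (i : Fin n) (f : (Fin n → ℝ) → ℝ) (x : Fin n → ℝ) : ℝ :=
  fderiv ℝ f x (ee i)

/-- `c_i(x, x̄)`: first-slot partial derivative of the cost. -/
def cI {n : ℕ} (c : (Fin n → ℝ) → (Fin n → ℝ) → ℝ) (x xbar : Fin n → ℝ) (i : Fin n) : ℝ :=
  pd i (fun y => c y xbar) x

/-- The matrix `b_{i s̄}(x, x̄) = −c_{i s̄}(x, x̄)`. -/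
def bMat {n : ℕ} (c : (Fin n → ℝ) → (Fin n → ℝ) → ℝ)
    (x xbar : Fin n → ℝ) : Matrix (Fin n) (Fin n) ℝ :=
  Matrix.of fun i s => -(fderiv ℝ (fun ybar => cI c x ybar i) xbar (ee s))

/-- The matrix field `w_{ij}(x) = u_{ij}(x) + c_{ij}(x, T x)`. -/
def wMat {n : ℕ} (u : (Fin n → ℝ) → ℝ) (c : (Fin n → ℝ) → (Fin n → ℝ) → ℝ)
    (T : (Fin n → ℝ) → (Fin n → ℝ)) (x : Fin n → ℝ) : Matrix (Fin n) (Fin n) ℝ :=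
  Matrix.of fun i j => pd j (fun y => pd i u y) x + pd j (fun y => cI c y (T x) i) x

/-- The conformal factor `λ = (ρ(x) ρ̄(T x)/det b(x,T x))^{1/(n−2)}`. -/
def lamF {n : ℕ} (c : (Fin n → ℝ) → (Fin n → ℝ) → ℝ) (T : (Fin n → ℝ) → (Fin n → ℝ))
    (ρ ρbar : (Fin n → ℝ) → ℝ) (x : Fin n → ℝ) : ℝ :=
  (ρ x * ρbar (T x) / (bMat c x (T x)).det) ^ ((1 : ℝ) / ((n : ℝ) - 2))

/-- `θ = log det w − log ρ + log(ρ̄∘T) − log det b`. -/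
def thetaF {n : ℕ} (u : (Fin n → ℝ) → ℝ) (c : (Fin n → ℝ) → (Fin n → ℝ) → ℝ)
    (T : (Fin n → ℝ) → (Fin n → ℝ)) (ρ ρbar : (Fin n → ℝ) → ℝ) (x : Fin n → ℝ) : ℝ :=
  Real.log (wMat u c T x).det - Real.log (ρ x) + Real.log (ρbar (T x))
    - Real.log (bMat c x (T x)).det

/-- Coordinate Laplace–Beltrami operator of the matrix field `g`. -/
def laplaceBeltrami {n : ℕ} (g : (Fin n → ℝ) → Matrix (Fin n) (Fin n) ℝ)
    (z : (Fin n → ℝ) → ℝ) (x : Fin n → ℝ) : ℝ :=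
  (Real.sqrt (g x).det)⁻¹ *
    ∑ j, pd j (fun y => Real.sqrt (g y).det * ∑ i, ((g y)⁻¹ i j) * pd i z y) x

/-- The linearized optimal transport operator
`L z = w^{ij} z_{ij} − w^{ij} b_{ij s̄} b^{s̄ k} z_k − b^{s̄ i} b_{s̄ i p̄} b^{p̄ k} z_k
      + (log ρ̄)_{s̄} b^{s̄ k} z_k`, all quantities evaluated along the graph `x̄ = T x`. -/
def Lop {n : ℕ} (u : (Fin n → ℝ) → ℝ) (c : (Fin n → ℝ) → (Fin n → ℝ) → ℝ)
    (T : (Fin n → ℝ) → (Fin n → ℝ)) (ρbar : (Fin n → ℝ) → ℝ)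
    (z : (Fin n → ℝ) → ℝ) (x : Fin n → ℝ) : ℝ :=
  (∑ i, ∑ j, ((wMat u c T x)⁻¹ i j) * pd j (fun y => pd i z y) x)
  - (∑ i, ∑ j, ∑ s, ∑ k, ((wMat u c T x)⁻¹ i j)
      * pd j (fun y => bMat c y (T x) i s) x
      * ((bMat c x (T x))⁻¹ s k) * pd k z x)
  - (∑ s, ∑ i, ∑ p, ∑ k, ((bMat c x (T x))⁻¹ s i)
      * fderiv ℝ (fun ybar => bMat c x ybar i s) (T x) (ee p)
      * ((bMat c x (T x))⁻¹ p k) * pd k z x)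
  + (∑ s, ∑ k, fderiv ℝ (fun ybar => Real.log (ρbar ybar)) (T x) (ee s)
      * ((bMat c x (T x))⁻¹ s k) * pd k z x)

end

theorem pd_contDiff {n : ℕ} {f : (Fin n → ℝ) → ℝ} (hf : ContDiff ℝ (⊤ : ℕ∞) f) (i : Fin n) :
    ContDiff ℝ (⊤ : ℕ∞) (pd i f) := by
  unfold pd
  exact (hf.fderiv_right (m := (⊤ : ℕ∞)) (by simp)).clm_apply contDiff_const

theorem dir_contDiff {V : Type*} [NormedAddCommGroup V] [NormedSpace ℝ V] {f : V → ℝ}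
    (hf : ContDiff ℝ (⊤ : ℕ∞) f) (v : V) :
    ContDiff ℝ (⊤ : ℕ∞) (fun p => fderiv ℝ f p v) :=
  (hf.fderiv_right (m := (⊤ : ℕ∞)) (by simp)).clm_apply contDiff_const

theorem smooth_diff {V : Type*} [NormedAddCommGroup V] [NormedSpace ℝ V] {f : V → ℝ}
    (hf : ContDiff ℝ (⊤ : ℕ∞) f) : Differentiable ℝ f :=
  hf.differentiable (by simp)

theorem dir_comm {V : Type*} [NormedAddCommGroup V] [NormedSpace ℝ V] {f : V → ℝ}
    (hf : ContDiff ℝ (⊤ : ℕ∞) f) (v w x : V) :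
    fderiv ℝ (fun p => fderiv ℝ f p v) x w = fderiv ℝ (fun p => fderiv ℝ f p w) x v := by
  have h1 : DifferentiableAt ℝ (fderiv ℝ f) x :=
    ((hf.fderiv_right (m := (⊤ : ℕ∞)) (by simp)).differentiable (by simp)) x
  have hs : IsSymmSndFDerivAt ℝ f x :=
    hf.contDiffAt.isSymmSndFDerivAt (by simp only [minSmoothness_of_isRCLikeNormedField]; exact WithTop.coe_le_coe.2 le_top)
  rw [fderiv_clm_apply h1 (differentiableAt_const v), fderiv_clm_apply h1 (differentiableAt_const w)]
  simpa using hs w v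

theorem pd_mul {n : ℕ} {f g : (Fin n → ℝ) → ℝ} {x : Fin n → ℝ} (hf : DifferentiableAt ℝ f x)
    (hg : DifferentiableAt ℝ g x) (j : Fin n) :
    pd j (fun y => f y * g y) x = f x * pd j g x + pd j f x * g x := by
  unfold pd
  rw [fderiv_fun_mul hf hg]
  simp [mul_comm]

theorem pd_sum {n : ℕ} {ι : Type*} (s : Finset ι) {f : ι → (Fin n → ℝ) → ℝ} {x : Fin n → ℝ}
    (hf : ∀ i ∈ s, DifferentiableAt ℝ (f i) x) (j : Fin n) :
    pd j (fun y => ∑ i ∈ s, f i y) x = ∑ i ∈ s, pd j (f i) x := by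
  unfold pd
  rw [fderiv_fun_sum hf]
  simp

theorem pd_const {n : ℕ} (a : ℝ) (x : Fin n → ℝ) (j : Fin n) :
    pd j (fun _ => a) x = 0 := by
  simp [pd]

theorem det_contDiff {n : ℕ} {V : Type*} [NormedAddCommGroup V] [NormedSpace ℝ V]
    {M : V → Matrix (Fin n) (Fin n) ℝ}
    (hM : ∀ i j, ContDiff ℝ (⊤ : ℕ∞) (fun y => M y i j)) :
    ContDiff ℝ (⊤ : ℕ∞) (fun y => (M y).det) := by
  simp only [Matrix.det_apply]
  refine ContDiff.sum fun σ _ => ?_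
  refine ContDiff.const_smul _ ?_
  exact contDiff_prod fun i _ => hM _ _

theorem adj_contDiff {n : ℕ} {V : Type*} [NormedAddCommGroup V] [NormedSpace ℝ V]
    {M : V → Matrix (Fin n) (Fin n) ℝ}
    (hM : ∀ i j, ContDiff ℝ (⊤ : ℕ∞) (fun y => M y i j)) (a b : Fin n) :
    ContDiff ℝ (⊤ : ℕ∞) (fun y => (M y).adjugate a b) := by
  simp only [Matrix.adjugate_apply]
  refine det_contDiff fun i j => ?_
  by_cases h : i = b
  · subst h
    simpa using contDiff_const
  · simpa [Matrix.updateRow_ne h] using hM i j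

theorem inv_contDiff {n : ℕ} {V : Type*} [NormedAddCommGroup V] [NormedSpace ℝ V]
    {M : V → Matrix (Fin n) (Fin n) ℝ}
    (hM : ∀ i j, ContDiff ℝ (⊤ : ℕ∞) (fun y => M y i j)) (hd : ∀ y, (M y).det ≠ 0)
    (a b : Fin n) :
    ContDiff ℝ (⊤ : ℕ∞) (fun y => (M y)⁻¹ a b) := by
  simp only [Matrix.inv_def, Ring.inverse_eq_inv', Matrix.smul_apply, smul_eq_mul]
  exact ((det_contDiff hM).inv hd).mul (adj_contDiff hM a b)

/-- Jacobi's formula. -/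
theorem pd_det {n : ℕ} {M : (Fin n → ℝ) → Matrix (Fin n) (Fin n) ℝ}
    (hM : ∀ i j, ContDiff ℝ (⊤ : ℕ∞) (fun y => M y i j)) (x : Fin n → ℝ) (j : Fin n) :
    pd j (fun y => (M y).det) x
      = ∑ k, ∑ l, (M x).adjugate l k * pd j (fun y => M y k l) x := by
  let D : ContinuousMultilinearMap ℝ (fun _ : Fin n => (Fin n → ℝ)) ℝ :=
    ⟨(Matrix.detRowAlternating : (Fin n → ℝ) [⋀^Fin n]→ₗ[ℝ] ℝ).toMultilinearMap, by
      change Continuous (fun A : Fin n → Fin n → ℝ => (Matrix.of A).det)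
      exact Continuous.matrix_det (by exact continuous_id)⟩
  have hD : ∀ A : Matrix (Fin n) (Fin n) ℝ, D A = A.det := fun A => rfl
  let m : (Fin n → ℝ) → (Fin n → Fin n → ℝ) := fun y k l => M y k l
  have hm : DifferentiableAt ℝ m x := by
    refine differentiableAt_pi.2 fun k => differentiableAt_pi.2 fun l => ?_
    exact smooth_diff (hM k l) x
  have h1 := (D.hasFDerivAt (m x)).comp x hm.hasFDerivAt
  have h2 : pd j (fun y => (M y).det) x = D.linearDeriv (m x) (fderiv ℝ m x (ee j)) := by
    unfold pd
    have : (fun y => (M y).det) = D ∘ m := rfl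
    rw [this, h1.fderiv]; rfl
  have h3 : ∀ k l, fderiv ℝ m x (ee j) k l = pd j (fun y => M y k l) x := by
    intro k l
    have e1 := hasFDerivAt_pi'.1 (hasFDerivAt_pi'.1 hm.hasFDerivAt k) l
    have e2 : HasFDerivAt (fun y => M y k l) _ x := e1
    unfold pd
    rw [e2.fderiv]
    rfl
  rw [h2, ContinuousMultilinearMap.linearDeriv_apply]
  refine Finset.sum_congr rfl fun k _ => ?_
  have h4 : D (Function.update (m x) k (fderiv ℝ m x (ee j) k))
      = ((M x).updateRow k (fderiv ℝ m x (ee j) k)).det := rfl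
  rw [h4, ← Matrix.cramer_transpose_apply, Matrix.cramer_eq_adjugate_mulVec,
    ← Matrix.adjugate_transpose]
  simp [Matrix.mulVec, dotProduct, h3]

theorem pd_inv {n : ℕ} {M : (Fin n → ℝ) → Matrix (Fin n) (Fin n) ℝ}
    (hM : ∀ i j, ContDiff ℝ (⊤ : ℕ∞) (fun y => M y i j)) (hd : ∀ y, (M y).det ≠ 0)
    (x : Fin n → ℝ) (j a b : Fin n) :
    pd j (fun y => (M y)⁻¹ a b) x
      = - ∑ k, ∑ l, (M x)⁻¹ a k * pd j (fun y => M y k l) x * (M x)⁻¹ l b := by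
  let dI : Matrix (Fin n) (Fin n) ℝ := Matrix.of fun a b => pd j (fun y => (M y)⁻¹ a b) x
  let dM : Matrix (Fin n) (Fin n) ℝ := Matrix.of fun a b => pd j (fun y => M y a b) x
  have hu : IsUnit (M x).det := (hd x).isUnit
  have key : (M x)⁻¹ * dM + dI * M x = 0 := by
    ext a b
    have h1 : pd j (fun y => ∑ k, (M y)⁻¹ a k * M y k b) x = 0 := by
      have : (fun y => ∑ k, (M y)⁻¹ a k * M y k b) = fun _ => (1 : Matrix (Fin n) (Fin n) ℝ) a b := by
        funext y
        rw [← Matrix.nonsing_inv_mul (M y) (hd y).isUnit, Matrix.mul_apply]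
      rw [this, pd_const]
    have hI := fun k => smooth_diff (inv_contDiff hM hd a k) x
    have hMd := fun k => smooth_diff (hM k b) x
    rw [pd_sum _ (fun k _ => (hI k).fun_mul (hMd k))] at h1
    simp only [pd_mul (hI _) (hMd _), Finset.sum_add_distrib] at h1
    simpa [Matrix.mul_apply, dI, dM] using h1
  have key2 : dI = - ((M x)⁻¹ * dM * (M x)⁻¹) := by
    have : dI * M x * (M x)⁻¹ = - ((M x)⁻¹ * dM) * (M x)⁻¹ := by
      rw [eq_neg_of_add_eq_zero_right key]
    rw [Matrix.mul_assoc, Matrix.mul_nonsing_inv _ hu, Matrix.mul_one] at this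
    rw [this, Matrix.neg_mul]
  have := congrFun (congrFun key2 a) b
  simp only [Matrix.neg_apply, Matrix.mul_apply, Finset.sum_mul, dI, dM, Matrix.of_apply] at this
  rw [this, Finset.sum_comm]

/-- Piola identity. -/
theorem piola {n : ℕ} {J : (Fin n → ℝ) → Matrix (Fin n) (Fin n) ℝ}
    (hM : ∀ i j, ContDiff ℝ (⊤ : ℕ∞) (fun y => J y i j)) (hd : ∀ y, (J y).det ≠ 0)
    (x : Fin n → ℝ) 
    (hsym : ∀ p j m, pd j (fun y => J y p m) x = pd m (fun y => J y p j) x) (s : Fin n) :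
    ∑ j, pd j (fun y => (J y).adjugate j s) x = 0 := by
  have hadj : ∀ y, (J y).adjugate = (J y).det • (J y)⁻¹ := by
    intro y
    rw [Matrix.inv_def, Ring.inverse_eq_inv', smul_smul, mul_inv_cancel₀ (hd y), one_smul]
  have h1 : ∀ j, pd j (fun y => (J y).adjugate j s) x = 
      (J x).det * ((∑ k, ∑ l, (J x)⁻¹ l k * pd j (fun y => J y k l) x * (J x)⁻¹ j s)
      - ∑ k, ∑ l, (J x)⁻¹ j k * pd j (fun y => J y k l) x * (J x)⁻¹ l s) := by
    intro j
    have : (fun y => (J y).adjugate j s) = fun y => (J y).det * (J y)⁻¹ j s := by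
      funext y; rw [hadj y]; simp
    rw [this, pd_mul (smooth_diff (det_contDiff hM) x) (smooth_diff (inv_contDiff hM hd j s) x),
      pd_inv hM hd, pd_det hM, hadj x]
    simp only [Matrix.smul_apply, smul_eq_mul, mul_sub, Finset.mul_sum, Finset.sum_mul, mul_neg]
    rw [neg_add_eq_sub]
    congr 1
    refine Finset.sum_congr rfl fun k _ => Finset.sum_congr rfl fun l _ => by ring
  simp only [h1, ← Finset.mul_sum, Finset.sum_sub_distrib]
  rw [mul_eq_zero]; right
  rw [sub_eq_zero, Finset.sum_comm]
  conv_rhs => rw [Finset.sum_comm]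
  refine Finset.sum_congr rfl fun k _ => ?_
  rw [Finset.sum_comm]
  refine Finset.sum_congr rfl fun l _ => Finset.sum_congr rfl fun m _ => ?_
  rw [hsym k m l]

theorem slice1 {V : Type*} [NormedAddCommGroup V] [NormedSpace ℝ V] {G : V × V → ℝ}
    (hG : ContDiff ℝ (⊤ : ℕ∞) G) (a b v : V) :
    fderiv ℝ (fun y => G (y, b)) a v = fderiv ℝ G (a, b) (v, 0) := by
  have h := ((smooth_diff hG) (a, b)).hasFDerivAt
  have h2 := HasFDerivAt.comp (f := fun y : V => (y, b)) a h (hasFDerivAt_prodMk_left a b)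
  have h3 : HasFDerivAt (fun y => G (y, b)) _ a := h2
  rw [h3.fderiv]; simp

theorem slice2 {V : Type*} [NormedAddCommGroup V] [NormedSpace ℝ V] {G : V × V → ℝ}
    (hG : ContDiff ℝ (⊤ : ℕ∞) G) (a b v : V) :
    fderiv ℝ (fun y => G (a, y)) b v = fderiv ℝ G (a, b) (0, v) := by
  have h := ((smooth_diff hG) (a, b)).hasFDerivAt
  have h2 := HasFDerivAt.comp (f := fun y : V => (a, y)) b h (hasFDerivAt_prodMk_right a b)
  have h3 : HasFDerivAt (fun y => G (a, y)) _ b := h2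
  rw [h3.fderiv]; simp

theorem lin_sum {n : ℕ} (L : (Fin n → ℝ) →ₗ[ℝ] ℝ) (v : Fin n → ℝ) :
    L v = ∑ s, L (ee s) * v s := by
  conv_lhs => rw [pi_eq_sum_univ' v]
  simp [map_sum, mul_comm, ee]

theorem fderiv_coord {n : ℕ} {T : (Fin n → ℝ) → (Fin n → ℝ)} (hT : ContDiff ℝ (⊤ : ℕ∞) T)
    (x : Fin n → ℝ) (j s : Fin n) :
    fderiv ℝ T x (ee j) s = pd j (fun y => T y s) x := by
  have h := hasFDerivAt_pi'.1 ((hT.differentiable (by simp)) x).hasFDerivAt s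
  unfold pd
  rw [h.fderiv]; rfl

theorem chain_graph {n : ℕ} {G : (Fin n → ℝ) × (Fin n → ℝ) → ℝ}
    (hG : ContDiff ℝ (⊤ : ℕ∞) G) {T : (Fin n → ℝ) → (Fin n → ℝ)}
    (hT : ContDiff ℝ (⊤ : ℕ∞) T) (x : Fin n → ℝ) (j : Fin n) :
    pd j (fun y => G (y, T y)) x = fderiv ℝ G (x, T x) (ee j, 0)
      + ∑ s, fderiv ℝ G (x, T x) (0, ee s) * pd j (fun y => T y s) x := by
  have h := ((smooth_diff hG) (x, T x)).hasFDerivAt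
  have hTd := ((hT.differentiable (by simp)) x).hasFDerivAt
  have h2 := HasFDerivAt.comp (f := fun y => (y, T y)) x h ((hasFDerivAt_id x).prodMk hTd)
  have h3 : HasFDerivAt (fun y => G (y, T y)) _ x := h2
  have h4 : pd j (fun y => G (y, T y)) x = fderiv ℝ G (x, T x) (ee j, fderiv ℝ T x (ee j)) := by
    unfold pd; rw [h3.fderiv]; rfl
  have h5 : ((ee j, fderiv ℝ T x (ee j)) : (Fin n → ℝ) × (Fin n → ℝ))
      = (ee j, 0) + (0, fderiv ℝ T x (ee j)) := by simp
  rw [h4, h5, map_add]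
  congr 1
  have := lin_sum ((fderiv ℝ G (x, T x)).toLinearMap ∘ₗ LinearMap.inr ℝ _ _) (fderiv ℝ T x (ee j))
  simpa [fderiv_coord hT] using this

theorem chain_T {n : ℕ} {G : (Fin n → ℝ) → ℝ}
    (hG : ContDiff ℝ (⊤ : ℕ∞) G) {T : (Fin n → ℝ) → (Fin n → ℝ)}
    (hT : ContDiff ℝ (⊤ : ℕ∞) T) (x : Fin n → ℝ) (j : Fin n) :
    pd j (fun y => G (T y)) x = ∑ s, fderiv ℝ G (T x) (ee s) * pd j (fun y => T y s) x := by
  have h := ((smooth_diff hG) (T x)).hasFDerivAt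
  have hTd := ((hT.differentiable (by simp)) x).hasFDerivAt
  have h3 : HasFDerivAt (fun y => G (T y)) _ x := HasFDerivAt.comp x h hTd
  have h4 : pd j (fun y => G (T y)) x = fderiv ℝ G (T x) (fderiv ℝ T x (ee j)) := by
    unfold pd; rw [h3.fderiv]; rfl
  rw [h4]
  have := lin_sum (fderiv ℝ G (T x)).toLinearMap (fderiv ℝ T x (ee j))
  simpa [fderiv_coord hT] using this

theorem alg_final {n : ℕ} (Wi Ji J bi : Fin n → Fin n → ℝ)
    (b1 b2 : Fin n → Fin n → Fin n → ℝ) (R z1 : Fin n → ℝ) (z2 : Fin n → Fin n → ℝ)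
    (hWe : ∀ j k, ∑ s, Ji j s * bi s k = Wi k j)
    (hJW : ∀ q k, ∑ j, J q j * Wi k j = bi q k)
    (hb2 : ∀ k l q, b2 k l q = b2 k q l) :
    ∑ j, ∑ s, Ji j s * ∑ i, (bi s i * z2 i j
      + (-(∑ k, ∑ l, bi s k * (b1 k l j + ∑ q, b2 k l q * J q j) * bi l i)
        + (∑ q, R q * J q j) * bi s i) * z1 i)
    = (∑ i, ∑ j, Wi i j * z2 i j)
      - (∑ i, ∑ j, ∑ s, ∑ k, Wi i j * b1 i s j * bi s k * z1 k)
      - (∑ s, ∑ i, ∑ p, ∑ k, bi s i * b2 i s p * bi p k * z1 k)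
      + (∑ s, ∑ k, R s * bi s k * z1 k) := by
  have e2 : ∀ (d : Fin n → Fin n → ℝ) (j i : Fin n),
      ∑ s, Ji j s * ∑ k, ∑ l, bi s k * d k l * bi l i = ∑ k, ∑ l, Wi k j * d k l * bi l i := by
    intro d j i
    have e : ∀ k l, Wi k j * d k l * bi l i = ∑ s, Ji j s * (bi s k * d k l * bi l i) := by
      intro k l
      rw [← hWe j k, Finset.sum_mul, Finset.sum_mul]
      exact Finset.sum_congr rfl fun s _ => by ring
    simp only [e, Finset.mul_sum]
    rw [Finset.sum_comm]
    refine Finset.sum_congr rfl fun k _ => ?_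
    rw [Finset.sum_comm]
  -- contract the index s
  have step1 : ∀ j, ∑ s, Ji j s * ∑ i, (bi s i * z2 i j
      + (-(∑ k, ∑ l, bi s k * (b1 k l j + ∑ q, b2 k l q * J q j) * bi l i)
        + (∑ q, R q * J q j) * bi s i) * z1 i)
      = ∑ i, (Wi i j * z2 i j
        + (-(∑ k, ∑ l, Wi k j * (b1 k l j + ∑ q, b2 k l q * J q j) * bi l i)
        + (∑ q, R q * J q j) * Wi i j) * z1 i) := by
    intro j
    have h0 : ∀ (f : Fin n → Fin n → ℝ), ∑ s, Ji j s * ∑ i, f s i = ∑ i, ∑ s, Ji j s * f s i := by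
      intro f
      simp only [Finset.mul_sum]
      rw [Finset.sum_comm]
    rw [h0]
    refine Finset.sum_congr rfl fun i _ => ?_
    rw [← e2 (fun k l => b1 k l j + ∑ q, b2 k l q * J q j) j i, ← hWe j i,
      Finset.sum_mul, Finset.mul_sum (a := ∑ q, R q * J q j), add_mul, neg_mul, Finset.sum_mul,
      Finset.sum_mul, ← Finset.sum_neg_distrib, ← Finset.sum_add_distrib,
      ← Finset.sum_add_distrib]
    exact Finset.sum_congr rfl fun s _ => by ring
  rw [Finset.sum_congr rfl fun j _ => step1 j]
  simp only [Finset.sum_add_distrib, add_mul, neg_mul, mul_add, Finset.sum_neg_distrib]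
  have A : ∑ j, ∑ i, Wi i j * z2 i j = ∑ i, ∑ j, Wi i j * z2 i j := Finset.sum_comm
  have B : ∑ j, ∑ i, (∑ k, ∑ l, Wi k j * b1 k l j * bi l i) * z1 i
      = ∑ i, ∑ j, ∑ s, ∑ k, Wi i j * b1 i s j * bi s k * z1 k := by
    conv_rhs => rw [Finset.sum_comm]
    refine Finset.sum_congr rfl fun j _ => ?_
    simp only [Finset.sum_mul]
    rw [Finset.sum_comm]
    refine Finset.sum_congr rfl fun k _ => ?_
    rw [Finset.sum_comm]
  have C0 : ∀ k l, ∑ j, Wi k j * (∑ q, b2 k l q * J q j) = ∑ q, bi q k * b2 k q l := by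
    intro k l
    simp only [← hJW, Finset.mul_sum, Finset.sum_mul]
    rw [Finset.sum_comm]
    exact Finset.sum_congr rfl fun s _ => Finset.sum_congr rfl fun j _ => by rw [hb2 k l s]; ring
  have C : ∑ j, ∑ i, (∑ k, ∑ l, Wi k j * (∑ q, b2 k l q * J q j) * bi l i) * z1 i
      = ∑ s, ∑ i, ∑ p, ∑ k, bi s i * b2 i s p * bi p k * z1 k := by
    have c1 : ∑ j, ∑ i, (∑ k, ∑ l, Wi k j * (∑ q, b2 k l q * J q j) * bi l i) * z1 i
        = ∑ k, ∑ l, ∑ j, Wi k j * (∑ q, b2 k l q * J q j) * (∑ i, bi l i * z1 i) := by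
      have : ∀ j, ∑ i, (∑ k, ∑ l, Wi k j * (∑ q, b2 k l q * J q j) * bi l i) * z1 i
          = ∑ k, ∑ l, Wi k j * (∑ q, b2 k l q * J q j) * (∑ i, bi l i * z1 i) := by
        intro j
        generalize hd : (fun k l => Wi k j * (∑ q, b2 k l q * J q j)) = d
        have hd' : ∀ k l, Wi k j * (∑ q, b2 k l q * J q j) = d k l := fun k l => by rw [← hd]
        simp only [hd', Finset.mul_sum, Finset.sum_mul]
        rw [Finset.sum_comm]
        refine Finset.sum_congr rfl fun k _ => ?_
        rw [Finset.sum_comm]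
        exact Finset.sum_congr rfl fun s _ => Finset.sum_congr rfl fun j _ => by ring
      rw [Finset.sum_congr rfl fun j _ => this j, Finset.sum_comm]
      refine Finset.sum_congr rfl fun k _ => ?_
      rw [Finset.sum_comm]
    rw [c1]
    conv_rhs => rw [Finset.sum_comm]
    refine Finset.sum_congr rfl fun k _ => ?_
    conv_rhs => rw [Finset.sum_comm]
    refine Finset.sum_congr rfl fun l _ => ?_
    rw [← Finset.sum_mul, C0, Finset.sum_mul]
    refine Finset.sum_congr rfl fun q _ => ?_
    rw [Finset.mul_sum]
    exact Finset.sum_congr rfl fun i _ => by ring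
  have D : ∑ j, ∑ i, (∑ q, R q * J q j) * Wi i j * z1 i = ∑ s, ∑ k, R s * bi s k * z1 k := by
    have : ∀ i, ∑ j, (∑ q, R q * J q j) * Wi i j = ∑ s, R s * bi s i := by
      intro i
      simp only [← hJW, Finset.mul_sum, Finset.sum_mul]
      rw [Finset.sum_comm]
      exact Finset.sum_congr rfl fun s _ => Finset.sum_congr rfl fun j _ => by ring
    rw [Finset.sum_comm]
    simp only [← Finset.sum_mul, this]
    simp only [Finset.sum_mul]
    exact Finset.sum_comm
  rw [A, B, C, D]
  ring

/-!
STATEMENT 7 (Proposition `LB` of the paper): at a smooth Lie solution `T` (a cost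
exponential of a locally exact 1-form `du` satisfying the mass balance), with
`g = λ w` and `θ` as above, the linearized operator satisfies
`L z = λ (Δ_g z + ½ ⟨∇θ, ∇z⟩_g)`.
-/
theorem stmt7 {n : ℕ} (hn : 3 ≤ n)
    (u z : (Fin n → ℝ) → ℝ) (c : (Fin n → ℝ) → (Fin n → ℝ) → ℝ)
    (T : (Fin n → ℝ) → (Fin n → ℝ)) (ρ ρbar : (Fin n → ℝ) → ℝ)
    (hu : ContDiff ℝ (⊤ : ℕ∞) u) (hz : ContDiff ℝ (⊤ : ℕ∞) z)
    (hc : ContDiff ℝ (⊤ : ℕ∞) (fun p : (Fin n → ℝ) × (Fin n → ℝ) => c p.1 p.2))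
    (hT : ContDiff ℝ (⊤ : ℕ∞) T) (hρ : ContDiff ℝ (⊤ : ℕ∞) ρ) (hρbar : ContDiff ℝ (⊤ : ℕ∞) ρbar)
    (hρpos : ∀ x, 0 < ρ x) (hρbarpos : ∀ x, 0 < ρbar x)
    -- `T` is the cost exponential of the (locally exact) 1-form `du`
    (contact : ∀ x i, pd i u x + cI c x (T x) i = 0)
    -- `w` is positive definite (local `c`-convexity), `b` is positive definite
    (hw : ∀ x, (wMat u c T x).PosDef)
    (hb : ∀ x, (bMat c x (T x)).PosDef)
    -- the mass balance (Lie solution): `det w = (ρ/(ρ̄∘T)) det b`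
    (hmass : ∀ x, (wMat u c T x).det = ρ x / ρbar (T x) * (bMat c x (T x)).det) :
    ∀ x, Lop u c T ρbar z x
      = lamF c T ρ ρbar x *
        (laplaceBeltrami (fun y => lamF c T ρ ρbar y • wMat u c T y) z x
          + (1 / 2) * ∑ i, ∑ j,
              (((lamF c T ρ ρbar x • wMat u c T x)⁻¹) i j)
                * pd i (thetaF u c T ρ ρbar) x * pd j z x) := by
  intro x
  -- joint functions
  set F : (Fin n → ℝ) × (Fin n → ℝ) → ℝ := fun p => c p.1 p.2 with hF
  set P : Fin n → (Fin n → ℝ) × (Fin n → ℝ) → ℝ := fun i p => fderiv ℝ F p (ee i, 0) with hP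
  set Bm : Fin n → Fin n → (Fin n → ℝ) × (Fin n → ℝ) → ℝ :=
    fun i s p => - fderiv ℝ (P i) p (0, ee s) with hBm
  have hPs : ∀ i, ContDiff ℝ (⊤ : ℕ∞) (P i) := fun i => dir_contDiff hc _
  have hBs : ∀ i s, ContDiff ℝ (⊤ : ℕ∞) (Bm i s) := fun i s => (dir_contDiff (hPs i) _).neg
  have hcI : ∀ a b i, cI c a b i = P i (a, b) := fun a b i => slice1 hc a b (ee i)
  have hbM : ∀ a b i s, bMat c a b i s = Bm i s (a, b) := by
    intro a b i s
    simp only [bMat, Matrix.of_apply, hcI, hBm]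
    rw [slice2 (hPs i)]
  set J : (Fin n → ℝ) → Matrix (Fin n) (Fin n) ℝ :=
    fun y => Matrix.of fun s j => pd j (fun y => T y s) y with hJdef
  have hTs : ∀ s, ContDiff ℝ (⊤ : ℕ∞) (fun y => T y s) := fun s => contDiff_pi.1 hT s
  have hJs : ∀ i j, ContDiff ℝ (⊤ : ℕ∞) (fun y => J y i j) := fun i j => pd_contDiff (hTs i) j
  set b : (Fin n → ℝ) → Matrix (Fin n) (Fin n) ℝ := fun y => bMat c y (T y) with hbdef
  have hbs : ∀ i j, ContDiff ℝ (⊤ : ℕ∞) (fun y => b y i j) := by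
    intro i j
    simp only [hbdef, hbM]
    exact (hBs i j).comp (contDiff_id.prodMk hT)
  set W : (Fin n → ℝ) → Matrix (Fin n) (Fin n) ℝ := fun y => wMat u c T y with hWdef
  have hWbJ : ∀ y, W y = b y * J y := by
    intro y
    ext i j
    have h0 : pd j (fun y => pd i u y + P i (y, T y)) y = 0 := by
      have : (fun y => pd i u y + P i (y, T y)) = fun _ => (0 : ℝ) := by
        funext y; rw [← hcI]; exact contact y i
      rw [this, pd_const]
    have h1 : pd j (fun y => pd i u y + P i (y, T y)) y
        = pd j (fun y => pd i u y) y + pd j (fun y => P i (y, T y)) y := by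
      have d1 : DifferentiableAt ℝ (fun y => pd i u y) y := smooth_diff (pd_contDiff hu i) y
      have d2 : DifferentiableAt ℝ (fun y => P i (y, T y)) y :=
        smooth_diff ((hPs i).comp (contDiff_id.prodMk hT)) y
      change fderiv ℝ _ y (ee j) = fderiv ℝ _ y (ee j) + fderiv ℝ _ y (ee j)
      rw [fderiv_fun_add d1 d2]; rfl
    rw [h1, chain_graph (hPs i) hT] at h0
    have h2 : W y i j = pd j (fun y => pd i u y) y + fderiv ℝ (P i) (y, T y) (ee j, 0) := by
      simp only [hWdef, wMat, Matrix.of_apply, hcI]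
      congr 1
      exact slice1 (hPs i) y (T y) (ee j)
    rw [h2, Matrix.mul_apply]
    have h3 : ∀ s, b y i s * J y s j
        = - (fderiv ℝ (P i) (y, T y) (0, ee s) * pd j (fun y => T y s) y) := by
      intro s
      simp only [hbdef, hbM, hBm, hJdef, Matrix.of_apply, neg_mul]
    simp only [h3, Finset.sum_neg_distrib]
    linarith
  have hbd : ∀ y, 0 < (b y).det := fun y => (hb y).det_pos
  have hWd : ∀ y, 0 < (W y).det := fun y => (hw y).det_pos
  have hJd : ∀ y, ρ y = ρbar (T y) * (J y).det := by
    intro y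
    have h1 : (W y).det = ρ y / ρbar (T y) * (b y).det := hmass y
    rw [hWbJ y, Matrix.det_mul] at h1
    have h2 : (J y).det = ρ y / ρbar (T y) :=
      mul_left_cancel₀ (hbd y).ne' (by rw [h1]; ring)
    rw [h2, mul_div_cancel₀ _ (hρbarpos _).ne']
  have hJd0 : ∀ y, (J y).det ≠ 0 := by
    intro y h
    have := hJd y
    rw [h, mul_zero] at this
    exact (hρpos y).ne' this
  have hWsym : ∀ y i j, (W y)⁻¹ i j = (W y)⁻¹ j i := by
    intro y i j
    have := (hw y).isHermitian.inv.apply j i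
    simpa using this
  have hWinv : ∀ y, (W y)⁻¹ = (J y)⁻¹ * (b y)⁻¹ := by
    intro y; rw [hWbJ y, Matrix.mul_inv_rev]
  -- theta vanishes
  have hth : ∀ i, pd i (thetaF u c T ρ ρbar) x = 0 := by
    intro i
    have : thetaF u c T ρ ρbar = fun _ => 0 := by
      funext y
      unfold thetaF
      rw [hmass y, Real.log_mul (div_pos (hρpos y) (hρbarpos _)).ne' (hbd y).ne',
        Real.log_div (hρpos y).ne' (hρbarpos _).ne']
      ring
    rw [this, pd_const]
  -- the conformal factor
  set lam : (Fin n → ℝ) → ℝ := lamF c T ρ ρbar with hlam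
  have hq : ∀ y, 0 < ρ y * ρbar (T y) / (b y).det :=
    fun y => div_pos (mul_pos (hρpos y) (hρbarpos _)) (hbd y)
  have hlpos : ∀ y, 0 < lam y := fun y => Real.rpow_pos_of_pos (hq y) _
  have hlpow : ∀ y, lam y ^ (n - 2) = ρ y * ρbar (T y) / (b y).det := by
    intro y
    have hn2 : ((n - 2 : ℕ) : ℝ) = (n : ℝ) - 2 := by
      rw [Nat.cast_sub (by omega)]; norm_num
    have hne : (n : ℝ) - 2 ≠ 0 := by
      rw [← hn2]; exact_mod_cast (by omega : n - 2 ≠ 0)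
    change ((ρ y * ρbar (T y) / (b y).det) ^ ((1 : ℝ) / ((n : ℝ) - 2))) ^ (n - 2) = _
    rw [← Real.rpow_natCast, ← Real.rpow_mul (hq y).le, hn2, one_div, inv_mul_cancel₀ hne,
      Real.rpow_one]
  have hsq : ∀ y, Real.sqrt (lam y • W y).det = lam y * ρ y := by
    intro y
    have h1 : (lam y • W y).det = (lam y * ρ y) ^ 2 := by
      have hm : (W y).det = ρ y / ρbar (T y) * (b y).det := hmass y
      have hp : lam y ^ n = lam y ^ 2 * lam y ^ (n - 2) := by
        rw [← pow_add]; congr 1; omega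
      rw [Matrix.det_smul, Fintype.card_fin, hp, hlpow, hm]
      have h3 := (hbd y).ne'
      have h4 := (hρbarpos (T y)).ne'
      field_simp
    rw [h1, Real.sqrt_sq (mul_pos (hlpos y) (hρpos y)).le]
  have hginv : ∀ y i j, (lam y • W y)⁻¹ i j = (lam y)⁻¹ * (W y)⁻¹ i j := by
    intro y i j
    have h2 : (lam y • W y)⁻¹ = (lam y)⁻¹ • (W y)⁻¹ := by
      refine Matrix.inv_eq_left_inv ?_
      rw [Matrix.smul_mul, Matrix.mul_smul, smul_smul, inv_mul_cancel₀ (hlpos y).ne', one_smul,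
        Matrix.nonsing_inv_mul _ (hWd y).ne'.isUnit]
    rw [h2]; rfl
  have hadj : ∀ y, (J y).adjugate = (J y).det • (J y)⁻¹ := by
    intro y
    rw [Matrix.inv_def, Ring.inverse_eq_inv', smul_smul, mul_inv_cancel₀ (hJd0 y), one_smul]
  set h : Fin n → (Fin n → ℝ) → ℝ :=
    fun s y => ∑ i, (ρbar (T y) * (b y)⁻¹ s i) * pd i z y with hh
  have hrT : ContDiff ℝ (⊤ : ℕ∞) (fun y => ρbar (T y)) := hρbar.comp hT
  have hbis := inv_contDiff hbs (fun y => (hbd y).ne')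
  have hhs : ∀ s, ContDiff ℝ (⊤ : ℕ∞) (h s) := by
    intro s
    exact ContDiff.sum fun i _ => (hrT.mul (hbis s i)).mul (pd_contDiff hz i)
  have hflux : ∀ j, (fun y => Real.sqrt (lam y • W y).det * ∑ i, ((lam y • W y)⁻¹ i j) * pd i z y)
      = fun y => ∑ s, (J y).adjugate j s * h s y := by
    intro j
    funext y
    rw [hsq y]
    have h1 : ∀ i, (lam y • W y)⁻¹ i j = (lam y)⁻¹ * ∑ s, (J y)⁻¹ j s * (b y)⁻¹ s i := by
      intro i
      rw [hginv, hWsym, hWinv, Matrix.mul_apply]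
    simp only [h1, hadj, hh, Finset.mul_sum, Finset.sum_mul]
    rw [Finset.sum_comm]
    refine Finset.sum_congr rfl fun s _ => Finset.sum_congr rfl fun i _ => ?_
    rw [hJd y]
    have := (hlpos y).ne'
    simp only [Matrix.smul_apply, smul_eq_mul]
    field_simp
  have hJsym : ∀ p j m, pd j (fun y => J y p m) x = pd m (fun y => J y p j) x := by
    intro p j m
    exact dir_comm (hTs p) (ee m) (ee j) x
  have hdiv : ∑ j, pd j (fun y => ∑ s, (J y).adjugate j s * h s y) x
      = ∑ j, ∑ s, (J x).adjugate j s * pd j (h s) x := by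
    have h1 : ∀ j, pd j (fun y => ∑ s, (J y).adjugate j s * h s y) x
        = ∑ s, (J x).adjugate j s * pd j (h s) x
          + ∑ s, pd j (fun y => (J y).adjugate j s) x * h s x := by
      intro j
      have d1 := fun s => smooth_diff (adj_contDiff hJs j s) x
      have d2 := fun s => smooth_diff (hhs s) x
      rw [pd_sum _ (fun s _ => (d1 s).fun_mul (d2 s)), ← Finset.sum_add_distrib]
      exact Finset.sum_congr rfl fun s _ => pd_mul (d1 s) (d2 s) j
    rw [Finset.sum_congr rfl fun j _ => h1 j, Finset.sum_add_distrib]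
    have h2 : ∑ j, ∑ s, pd j (fun y => (J y).adjugate j s) x * h s x = 0 := by
      rw [Finset.sum_comm]
      refine Finset.sum_eq_zero fun s _ => ?_
      rw [← Finset.sum_mul, piola hJs hJd0 x hJsym s, zero_mul]
    rw [h2, add_zero]
  -- abbreviations for the derivatives of b and log ρbar
  set R : Fin n → ℝ := fun s => fderiv ℝ (fun ybar => Real.log (ρbar ybar)) (T x) (ee s) with hR
  set b1 : Fin n → Fin n → Fin n → ℝ := fun i s j => fderiv ℝ (Bm i s) (x, T x) (ee j, 0) with hb1
  set b2 : Fin n → Fin n → Fin n → ℝ := fun i s p => fderiv ℝ (Bm i s) (x, T x) (0, ee p) with hb2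
  have hb2s : ∀ k l q, b2 k l q = b2 k q l := by
    intro k l q
    have e := dir_comm (hPs k) (0, ee l) (0, ee q) (x, T x)
    simp only [hb2, hBm, fderiv_fun_neg]
    exact congrArg Neg.neg e
  have hRr : ∀ j, pd j (fun y => ρbar (T y)) x = ρbar (T x) * ∑ q, R q * J x q j := by
    intro j
    rw [chain_T hρbar hT, Finset.mul_sum]
    refine Finset.sum_congr rfl fun q _ => ?_
    have hl : R q = (ρbar (T x))⁻¹ * fderiv ℝ ρbar (T x) (ee q) := by
      simp only [hR]
      rw [fderiv.log (smooth_diff hρbar (T x)) (hρbarpos _).ne']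
      rfl
    rw [hl]
    have := (hρbarpos (T x)).ne'
    simp only [hJdef, Matrix.of_apply]
    field_simp
  have hdb : ∀ j k l, pd j (fun y => b y k l) x = b1 k l j + ∑ q, b2 k l q * J x q j := by
    intro j k l
    simp only [hbdef, hbM]
    exact chain_graph (hBs k l) hT x j
  have hdh : ∀ s j, pd j (h s) x = ρbar (T x) * ∑ i, ((b x)⁻¹ s i * pd j (fun y => pd i z y) x
      + (-(∑ k, ∑ l, (b x)⁻¹ s k * (b1 k l j + ∑ q, b2 k l q * J x q j) * (b x)⁻¹ l i)
        + (∑ q, R q * J x q j) * (b x)⁻¹ s i) * pd i z x) := by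
    intro s j
    have d1 := smooth_diff hrT x
    have d2 := fun i => smooth_diff (hbis s i) x
    have d3 := fun i => smooth_diff (pd_contDiff hz i) x
    simp only [hh]
    rw [pd_sum _ (fun i _ => (d1.fun_mul (d2 i)).fun_mul (d3 i)), Finset.mul_sum]
    refine Finset.sum_congr rfl fun i _ => ?_
    rw [pd_mul (d1.fun_mul (d2 i)) (d3 i), pd_mul d1 (d2 i), hRr,
      pd_inv hbs (fun y => (hbd y).ne')]
    simp only [hdb]
    ring
  have halg := alg_final (fun i j => (W x)⁻¹ i j) (fun i j => (J x)⁻¹ i j) (fun i j => J x i j)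
    (fun i j => (b x)⁻¹ i j) b1 b2 R (fun i => pd i z x) (fun i j => pd j (fun y => pd i z y) x)
    (fun j k => by rw [hWsym, hWinv, Matrix.mul_apply])
    (fun q k => by
      have : J x * (W x)⁻¹ = (b x)⁻¹ := by
        rw [hWinv, ← Matrix.mul_assoc, Matrix.mul_nonsing_inv _ (hJd0 x).isUnit, Matrix.one_mul]
      rw [← this, Matrix.mul_apply]
      exact Finset.sum_congr rfl fun j _ => by rw [hWsym])
    hb2s
  have hL : Lop u c T ρbar z x = (∑ i, ∑ j, (W x)⁻¹ i j * pd j (fun y => pd i z y) x)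
      - (∑ i, ∑ j, ∑ s, ∑ k, (W x)⁻¹ i j * b1 i s j * (b x)⁻¹ s k * pd k z x)
      - (∑ s, ∑ i, ∑ p, ∑ k, (b x)⁻¹ s i * b2 i s p * (b x)⁻¹ p k * pd k z x)
      + (∑ s, ∑ k, R s * (b x)⁻¹ s k * pd k z x) := by
    have e1 : ∀ i s j, pd j (fun y => bMat c y (T x) i s) x = b1 i s j := by
      intro i s j
      simp only [hbM]
      exact slice1 (hBs i s) x (T x) (ee j)
    have e2 : ∀ i s p, fderiv ℝ (fun ybar => bMat c x ybar i s) (T x) (ee p) = b2 i s p := by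
      intro i s p
      simp only [hbM]
      exact slice2 (hBs i s) x (T x) (ee p)
    unfold Lop
    simp only [e1, e2]
    rfl
  have hLB : lam x * laplaceBeltrami (fun y => lam y • W y) z x = Lop u c T ρbar z x := by
    unfold laplaceBeltrami
    simp only [hflux]
    rw [hdiv, hsq x, hL, ← halg, hJd x, Finset.mul_sum, Finset.mul_sum]
    refine Finset.sum_congr rfl fun j _ => ?_
    rw [Finset.mul_sum, Finset.mul_sum]
    refine Finset.sum_congr rfl fun s _ => ?_
    rw [hdh, hadj]
    have g1 := (hlpos x).ne'
    have g2 := (hρbarpos (T x)).ne'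
    have g3 := hJd0 x
    simp only [Matrix.smul_apply, smul_eq_mul]
    generalize (∑ i, ((b x)⁻¹ s i * pd j (fun y => pd i z y) x
      + (-(∑ k, ∑ l, (b x)⁻¹ s k * (b1 k l j + ∑ q, b2 k l q * J x q j) * (b x)⁻¹ l i)
        + (∑ q, R q * J x q j) * (b x)⁻¹ s i) * pd i z x)) = S
    field_simp
  have hz0 : ∑ i, ∑ j, (((lam x • wMat u c T x)⁻¹) i j)
                * pd i (thetaF u c T ρ ρbar) x * pd j z x = 0 := by
    simp [hth]
  rw [hz0, mul_zero, add_zero]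
  exact hLB.symm
end

section
/- In particular, if θ is constant (equivalently, at a Lie solution where log det w = log ρ − log(ρ̄∘T) + log det b holds identically), then the linearized optimal transport operator equals λ Δ_g: i.e. L z = λ Δ_g z, so L is, up to the positive factor λ, the Laplace–Beltrami operator of the metric g = λ w. -/
theorem alg8 {n : ℕ} (W B DT : Matrix (Fin n) (Fin n) ℝ) (dW : Fin n → Matrix (Fin n) (Fin n) ℝ)
    (dWi : Fin n → Matrix (Fin n) (Fin n) ℝ)
    (S β γ db : Fin n → Fin n → Fin n → ℝ) (r lr : Fin n → ℝ)
    (hWs : W⁻¹.transpose = W⁻¹) (hW : IsUnit W.det) (hB : IsUnit B.det)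
    (hWB : W = B * DT)
    (hS1 : ∀ a b j, S a b j = S a j b)
    (hS2 : ∀ a b j, S a b j = S b a j)
    (hβ : ∀ a b s, β a b s = β b a s)
    (hdW : ∀ j a b, dW j a b = S a b j - ∑ s, β a b s * DT s j)
    (hdWi : ∀ j, dW j * W⁻¹ + W * dWi j = 0)
    (hdb : ∀ j l s, db j l s = β l j s + ∑ p, γ l s p * DT p j)
    (hl : ∀ j, lr j = ∑ a, ∑ b, W⁻¹ a b * dW j b a - (∑ s, ∑ l, B⁻¹ s l * db j l s)
      + ∑ s, r s * DT s j) (k : Fin n) :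
    ∑ j, (dWi j k j + lr j * W⁻¹ k j) =
      - (∑ i, ∑ j, ∑ s, W⁻¹ i j * β i j s * B⁻¹ s k)
      - (∑ s, ∑ i, ∑ p, B⁻¹ s i * γ i s p * B⁻¹ p k) + ∑ s, r s * B⁻¹ s k := by
  have hsym : ∀ i j, W⁻¹ i j = W⁻¹ j i := fun i j => congrFun (congrFun hWs j) i
  have hTW : DT * W⁻¹ = B⁻¹ := by
    have : DT = B⁻¹ * W := by rw [hWB, ← Matrix.mul_assoc, Matrix.nonsing_inv_mul _ hB, one_mul]
    rw [this, Matrix.mul_assoc, Matrix.mul_nonsing_inv _ hW, mul_one]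
  have hT : ∀ s k, ∑ j, DT s j * W⁻¹ j k = B⁻¹ s k := fun s k => by
    rw [← hTW, Matrix.mul_apply]
  have hT' : ∀ s k, ∑ j, DT s j * W⁻¹ k j = B⁻¹ s k := fun s k => by
    rw [← hT]; exact Finset.sum_congr rfl fun j _ => by rw [hsym]
  have e0 : ∀ j, dWi j = - (W⁻¹ * (dW j * W⁻¹)) := by
    intro j
    have h1 : W * dWi j = -(dW j * W⁻¹) := eq_neg_of_add_eq_zero_right (hdWi j)
    calc dWi j = W⁻¹ * (W * dWi j) := by
          rw [← Matrix.mul_assoc, Matrix.nonsing_inv_mul _ hW, one_mul]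
      _ = _ := by rw [h1, Matrix.mul_neg]
  -- the term `P` with the symmetric tensor
  have e1 : ∑ j, dWi j k j = - (∑ j, ∑ a, ∑ b, W⁻¹ k a * W⁻¹ b j * S a b j)
      + ∑ a, ∑ b, ∑ s, W⁻¹ k a * β a b s * B⁻¹ s b := by
    have : ∀ j, dWi j k j = - (∑ a, ∑ b, W⁻¹ k a * W⁻¹ b j * S a b j)
      + ∑ a, ∑ b, ∑ s, W⁻¹ k a * β a b s * (DT s j * W⁻¹ b j) := by
      intro j
      rw [e0, Matrix.neg_apply, Matrix.mul_apply, ← Finset.sum_neg_distrib, 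
        ← Finset.sum_neg_distrib, ← Finset.sum_add_distrib]
      refine Finset.sum_congr rfl fun a _ => ?_
      rw [Matrix.mul_apply, Finset.mul_sum, ← Finset.sum_neg_distrib, 
        ← Finset.sum_neg_distrib, ← Finset.sum_add_distrib]
      refine Finset.sum_congr rfl fun b _ => ?_
      rw [hdW]
      have : ∑ s, W⁻¹ k a * β a b s * (DT s j * W⁻¹ b j) =
        W⁻¹ k a * W⁻¹ b j * ∑ s, β a b s * DT s j := by
        rw [Finset.mul_sum]; exact Finset.sum_congr rfl fun s _ => by ring
      rw [this]; ring
    simp_rw [this, Finset.sum_add_distrib, Finset.sum_neg_distrib]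
    congr 1
    rw [Finset.sum_comm]
    refine Finset.sum_congr rfl fun a _ => ?_
    rw [Finset.sum_comm]
    refine Finset.sum_congr rfl fun b _ => ?_
    rw [Finset.sum_comm]
    refine Finset.sum_congr rfl fun s _ => ?_
    rw [← Finset.mul_sum, hT']
  have e2 : ∑ j, (∑ a, ∑ b, W⁻¹ a b * dW j b a) * W⁻¹ k j =
      (∑ j, ∑ a, ∑ b, W⁻¹ k a * W⁻¹ b j * S a b j)
      - ∑ i, ∑ j, ∑ s, W⁻¹ i j * β i j s * B⁻¹ s k := by
    have h1 : ∑ j, ∑ a, ∑ b, W⁻¹ k a * W⁻¹ b j * S a b j =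
        ∑ j, ∑ a, ∑ b, W⁻¹ k j * (W⁻¹ a b * S b a j) := by
      rw [Finset.sum_comm]
      refine Finset.sum_congr rfl fun j _ => Finset.sum_congr rfl fun a _ =>
        Finset.sum_congr rfl fun b _ => ?_
      rw [hsym b a, hS2 j b a, hS1 b j a]; ring
    have h2 : ∑ i, ∑ j, ∑ s, W⁻¹ i j * β i j s * B⁻¹ s k =
        ∑ j, ∑ a, ∑ b, W⁻¹ k j * (W⁻¹ a b * ∑ s, β b a s * DT s j) := by
      rw [Finset.sum_comm]
      simp_rw [← hT', Finset.mul_sum]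
      conv_rhs => rw [Finset.sum_comm]
      rw [Finset.sum_comm]
      refine Finset.sum_congr rfl fun a _ => ?_
      conv_rhs => rw [Finset.sum_comm]
      refine Finset.sum_congr rfl fun b _ => ?_
      conv_rhs => rw [Finset.sum_comm]
      refine Finset.sum_congr rfl fun s _ => Finset.sum_congr rfl fun j _ => ?_
      rw [hβ a b]; ring
    rw [h1, h2, ← Finset.sum_sub_distrib]
    refine Finset.sum_congr rfl fun j _ => ?_
    rw [Finset.sum_mul, ← Finset.sum_sub_distrib]
    refine Finset.sum_congr rfl fun a _ => ?_
    rw [Finset.sum_mul, ← Finset.sum_sub_distrib]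
    refine Finset.sum_congr rfl fun b _ => ?_
    rw [hdW]; ring
  have e3 : ∑ j, (∑ s, ∑ l, B⁻¹ s l * db j l s) * W⁻¹ k j =
      (∑ a, ∑ b, ∑ s, W⁻¹ k a * β a b s * B⁻¹ s b)
      + ∑ s, ∑ i, ∑ p, B⁻¹ s i * γ i s p * B⁻¹ p k := by
    have h1 : ∑ a, ∑ b, ∑ s, W⁻¹ k a * β a b s * B⁻¹ s b =
        ∑ j, ∑ s, ∑ l, W⁻¹ k j * (B⁻¹ s l * β l j s) := by
      refine Finset.sum_congr rfl fun j _ => ?_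
      rw [Finset.sum_comm]
      refine Finset.sum_congr rfl fun a _ =>
        Finset.sum_congr rfl fun b _ => ?_
      rw [hβ]; ring
    have h2 : ∑ s, ∑ i, ∑ p, B⁻¹ s i * γ i s p * B⁻¹ p k =
        ∑ j, ∑ s, ∑ l, W⁻¹ k j * (B⁻¹ s l * ∑ p, γ l s p * DT p j) := by
      simp_rw [← hT', Finset.mul_sum]
      conv_rhs => rw [Finset.sum_comm]
      refine Finset.sum_congr rfl fun a _ => ?_
      conv_rhs => rw [Finset.sum_comm]
      refine Finset.sum_congr rfl fun b _ => ?_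
      conv_rhs => rw [Finset.sum_comm]
      refine Finset.sum_congr rfl fun s _ => Finset.sum_congr rfl fun j _ => ?_
      rw [hT']; ring
    rw [h1, h2, ← Finset.sum_add_distrib]
    refine Finset.sum_congr rfl fun j _ => ?_
    rw [Finset.sum_mul, ← Finset.sum_add_distrib]
    refine Finset.sum_congr rfl fun a _ => ?_
    rw [Finset.sum_mul, ← Finset.sum_add_distrib]
    refine Finset.sum_congr rfl fun b _ => ?_
    rw [hdb]; ring
  have e4 : ∑ j, (∑ s, r s * DT s j) * W⁻¹ k j = ∑ s, r s * B⁻¹ s k := by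
    simp_rw [Finset.sum_mul]
    rw [Finset.sum_comm]
    refine Finset.sum_congr rfl fun s _ => ?_
    rw [← hT', Finset.mul_sum]
    exact Finset.sum_congr rfl fun j _ => by ring
  simp_rw [hl, Finset.sum_add_distrib, add_mul, sub_mul, Finset.sum_add_distrib,
    Finset.sum_sub_distrib]
  rw [e1, e2, e3, e4]; ring

theorem jac8 {n : ℕ} {E : Type*} [NormedAddCommGroup E] [NormedSpace ℝ E]
    (A : E → Matrix (Fin n) (Fin n) ℝ) (x v : E)
    (hA : ∀ i j, DifferentiableAt ℝ (fun y => A y i j) x) :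
    DifferentiableAt ℝ (fun y => (A y).det) x ∧
    fderiv ℝ (fun y => (A y).det) x v =
      ∑ a, ∑ b, (A x).adjugate a b * fderiv ℝ (fun y => A y b a) x v := by
  let L : ContinuousMultilinearMap ℝ (fun _ : Fin n => (Fin n → ℝ)) ℝ :=
    ⟨(Matrix.detRowAlternating (R := ℝ) (n := Fin n)).toMultilinearMap, by
      show Continuous fun M : Matrix (Fin n) (Fin n) ℝ => M.det
      exact continuous_id.matrix_det⟩
  let A' : E → (Fin n → Fin n → ℝ) := fun y i j => A y i j
  have hA' : HasFDerivAt A' (ContinuousLinearMap.pi fun i => ContinuousLinearMap.pi fun j =>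
      fderiv ℝ (fun y => A y i j) x) x := by
    rw [hasFDerivAt_pi]; intro i
    rw [hasFDerivAt_pi]; intro j
    exact (hA i j).hasFDerivAt
  have h := (L.hasFDerivAt (A' x)).comp x hA'
  have h' : HasFDerivAt (fun y => (A y).det) _ x := h
  refine ⟨h'.differentiableAt, ?_⟩
  rw [h'.fderiv, Finset.sum_comm]
  simp only [ContinuousLinearMap.comp_apply, ContinuousMultilinearMap.linearDeriv_apply]
  refine Finset.sum_congr rfl fun i _ => ?_
  have : L (Function.update (A' x) i ((ContinuousLinearMap.pi fun i => ContinuousLinearMap.pi fun j =>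
      fderiv ℝ (fun y => A y i j) x) v i)) = ((A x).updateRow i (fun j => fderiv ℝ (fun y => A y i j) x v)).det := rfl
  rw [this, ← Matrix.cramer_transpose_apply, Matrix.cramer_eq_adjugate_mulVec, Matrix.mulVec, dotProduct,
    ← Matrix.adjugate_transpose]
  rfl

theorem logdet8 {n : ℕ} {E : Type*} [NormedAddCommGroup E] [NormedSpace ℝ E]
    (A : E → Matrix (Fin n) (Fin n) ℝ) (x v : E)
    (hA : ∀ i j, DifferentiableAt ℝ (fun y => A y i j) x) (hd : (A x).det ≠ 0) :
    DifferentiableAt ℝ (fun y => Real.log (A y).det) x ∧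
    fderiv ℝ (fun y => Real.log (A y).det) x v =
      ∑ a, ∑ b, (A x)⁻¹ a b * fderiv ℝ (fun y => A y b a) x v := by
  obtain ⟨h1, h2⟩ := jac8 A x v hA
  refine ⟨h1.log hd, ?_⟩
  rw [fderiv.log h1 hd, smul_apply, h2, Matrix.inv_def, Finset.smul_sum]
  refine Finset.sum_congr rfl fun a _ => ?_
  rw [Finset.smul_sum]
  refine Finset.sum_congr rfl fun b _ => ?_
  simp [mul_assoc]

theorem invdiff8 {n : ℕ} {E : Type*} [NormedAddCommGroup E] [NormedSpace ℝ E]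
    (A : E → Matrix (Fin n) (Fin n) ℝ) (x : E)
    (hA : ∀ i j, DifferentiableAt ℝ (fun y => A y i j) x) (hd : (A x).det ≠ 0) (i j) :
    DifferentiableAt ℝ (fun y => (A y)⁻¹ i j) x := by
  have h1 := (jac8 A x 0 hA).1
  have h2 : DifferentiableAt ℝ (fun y => (A y).adjugate i j) x := by
    simp only [Matrix.adjugate_apply]
    refine (jac8 (fun y => (A y).updateRow j (Pi.single i 1)) x 0 ?_).1
    intro a b
    by_cases h : a = j
    · subst h; simp
    · simpa [Matrix.updateRow_ne h] using hA a b
  have h3 : DifferentiableAt ℝ (fun y => (A y).det⁻¹ * (A y).adjugate i j) x :=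
    (h1.inv hd).mul h2
  simpa [Matrix.inv_def] using h3

theorem invder8 {n : ℕ} {E : Type*} [NormedAddCommGroup E] [NormedSpace ℝ E]
    (A : E → Matrix (Fin n) (Fin n) ℝ) (x v : E)
    (hA : ∀ i j, DifferentiableAt ℝ (fun y => A y i j) x) (hd : ∀ y, (A y).det ≠ 0) :
    Matrix.of (fun i j => fderiv ℝ (fun y => A y i j) x v) * (A x)⁻¹ +
      A x * Matrix.of (fun i j => fderiv ℝ (fun y => (A y)⁻¹ i j) x v) = 0 := by
  have hI := invdiff8 A x hA (hd x)
  ext i k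
  have h0 : (fun y => ∑ j, A y i j * (A y)⁻¹ j k) = fun _ => (1 : Matrix (Fin n) (Fin n) ℝ) i k := by
    funext y
    rw [← Matrix.mul_apply, Matrix.mul_nonsing_inv _ (isUnit_iff_ne_zero.2 (hd y))]
  have h1 : HasFDerivAt (fun y => ∑ j, A y i j * (A y)⁻¹ j k) _ x :=
    HasFDerivAt.fun_sum fun j _ => (hA i j).hasFDerivAt.mul (hI j k).hasFDerivAt
  have h2 := congrArg (fun L => L v) h1.fderiv
  rw [h0] at h2
  simp only [fderiv_fun_const] at h2
  simp only [Matrix.add_apply, Matrix.mul_apply, Matrix.of_apply, Matrix.zero_apply,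
    ← Finset.sum_add_distrib]
  simp at h2
  rw [h2]
  exact Finset.sum_congr rfl fun j _ => by ring

section
variable {G : Type*} [NormedAddCommGroup G] [NormedSpace ℝ G]

theorem smD8 {F : G → ℝ} (hF : ContDiff ℝ (⊤ : ℕ∞) F) (v : G) :
    ContDiff ℝ (⊤ : ℕ∞) (fun p => fderiv ℝ F p v) :=
  (hF.fderiv_right (m := (⊤ : ℕ∞)) (by simp)).clm_apply contDiff_const

theorem commD8 {F : G → ℝ} (hF : ContDiff ℝ (⊤ : ℕ∞) F) (v w p : G) :
    fderiv ℝ (fun p => fderiv ℝ F p v) p w = fderiv ℝ (fun p => fderiv ℝ F p w) p v := by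
  have hs : IsSymmSndFDerivAt ℝ F p :=
    (hF.contDiffAt).isSymmSndFDerivAt (by simp only [minSmoothness_of_isRCLikeNormedField]; exact WithTop.coe_le_coe.2 le_top)
  have hd : DifferentiableAt ℝ (fderiv ℝ F) p :=
    ((hF.fderiv_right (m := (⊤ : ℕ∞)) (by simp)).differentiable (by simp)) p
  rw [fderiv_clm_apply hd (differentiableAt_const v), fderiv_clm_apply hd (differentiableAt_const w)]
  simpa using hs w v

theorem slot1 {F : G × G → ℝ} (hF : ContDiff ℝ (⊤ : ℕ∞) F) (x a v : G) :
    fderiv ℝ (fun y => F (y, a)) x v = fderiv ℝ F (x, a) (v, 0) := by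
  have h : HasFDerivAt (fun y : G => (y, a)) ((ContinuousLinearMap.id ℝ G).prod 0) x :=
    (hasFDerivAt_id x).prodMk (hasFDerivAt_const a x)
  have := ((hF.differentiable (by simp)) (x, a)).hasFDerivAt.comp x h
  have h' : HasFDerivAt (fun y => F (y, a)) _ x := this
  rw [h'.fderiv]; simp

theorem slot2 {F : G × G → ℝ} (hF : ContDiff ℝ (⊤ : ℕ∞) F) (x a v : G) :
    fderiv ℝ (fun y => F (x, y)) a v = fderiv ℝ F (x, a) (0, v) := by
  have h : HasFDerivAt (fun y : G => (x, y)) ((0 : G →L[ℝ] G).prod (ContinuousLinearMap.id ℝ G)) a :=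
    (hasFDerivAt_const x a).prodMk (hasFDerivAt_id a)
  have := ((hF.differentiable (by simp)) (x, a)).hasFDerivAt.comp a h
  have h' : HasFDerivAt (fun y => F (x, y)) _ a := this
  rw [h'.fderiv]; simp
end

theorem vsum8 {n : ℕ}
    (L : (Fin n → ℝ) →L[ℝ] ℝ) (d : Fin n → ℝ) :
    L d = ∑ s, L (Pi.single s 1) * d s := by
  conv_lhs => rw [← Finset.univ_sum_single d]
  rw [map_sum]
  refine Finset.sum_congr rfl fun s _ => ?_
  have : (Pi.single s (d s) : Fin n → ℝ) = d s • Pi.single s 1 := by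
    rw [← Pi.single_smul]; simp
  rw [this, map_smul, smul_eq_mul, mul_comm]

theorem chain8 {n : ℕ} {F : (Fin n → ℝ) × (Fin n → ℝ) → ℝ} (hF : ContDiff ℝ (⊤ : ℕ∞) F)
    {T : (Fin n → ℝ) → (Fin n → ℝ)} (hT : ContDiff ℝ (⊤ : ℕ∞) T) (x v : Fin n → ℝ) :
    fderiv ℝ (fun y => F (y, T y)) x v = fderiv ℝ F (x, T x) (v, 0) +
      ∑ s, fderiv ℝ F (x, T x) (0, ee s) * fderiv ℝ (fun y => T y s) x v := by
  have hTd := (hT.differentiable (by simp)) x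
  have h := (hasFDerivAt_id x).prodMk hTd.hasFDerivAt
  have h1 := ((hF.differentiable (by simp)) (x, T x)).hasFDerivAt.comp x h
  have h' : HasFDerivAt (fun y => F (y, T y)) _ x := h1
  have e : ∀ s, fderiv ℝ (fun y => T y s) x v = fderiv ℝ T x v s := by
    intro s
    have := (hasFDerivAt_pi'.1 hTd.hasFDerivAt s).fderiv
    rw [this]; rfl
  have e2 := vsum8 ((fderiv ℝ F (x, T x)).comp (ContinuousLinearMap.inr ℝ _ _)) (fderiv ℝ T x v)
  simp only [ContinuousLinearMap.comp_apply, ContinuousLinearMap.inr_apply] at e2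
  simp_rw [e]
  rw [h'.fderiv, ← e2, ← map_add]
  simp

theorem lam8 {n : ℕ} (hn : 3 ≤ n) {r rb d D lam : ℝ} (hr : 0 < r) (hrb : 0 < rb) (hd : 0 < d)
    (hD : 0 < D) (hl : lam = (r * rb / d) ^ ((1 : ℝ) / ((n : ℝ) - 2)))
    (h : Real.log D = Real.log r - Real.log rb + Real.log d) :
    0 < lam ∧ Real.sqrt (lam ^ n * D) = lam * r := by
  have hq : 0 < r * rb / d := by positivity
  have hpos : 0 < lam := by rw [hl]; positivity
  refine ⟨hpos, ?_⟩
  have hDe : D = r * d / rb := by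
    apply Real.log_injOn_pos (Set.mem_Ioi.2 hD) (Set.mem_Ioi.2 (by positivity))
    rw [h, Real.log_div (by positivity) (by positivity), Real.log_mul (by positivity) (by positivity)]
    ring
  have hp : lam ^ (n - 2) = r * rb / d := by
    rw [hl, ← Real.rpow_natCast, ← Real.rpow_mul hq.le]
    have : ((n - 2 : ℕ) : ℝ) = (n : ℝ) - 2 := by
      rw [Nat.cast_sub (by omega)]; norm_num
    rw [this]
    have h3 : (3 : ℝ) ≤ n := by exact_mod_cast hn
    rw [one_div_mul_cancel (by linarith), Real.rpow_one]
  have : lam ^ n * D = (lam * r) ^ 2 := by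
    have hn2 : lam ^ n = lam ^ (n - 2) * lam ^ 2 := by rw [← pow_add]; congr 1; omega
    rw [hn2, hp, hDe]; field_simp
  rw [this, Real.sqrt_sq (by positivity)]

/-!
STATEMENT 8: If `θ` is constant (equivalently, `log det w = log ρ − log(ρ̄∘T) + log det b`
holds identically, as at a Lie solution), then `L z = λ Δ_g z`: up to the positive
factor `λ`, the linearized operator is the Laplace–Beltrami operator of `g = λ w`.
-/
theorem stmt8 {n : ℕ} (hn : 3 ≤ n)
    (u z : (Fin n → ℝ) → ℝ) (c : (Fin n → ℝ) → (Fin n → ℝ) → ℝ)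
    (T : (Fin n → ℝ) → (Fin n → ℝ)) (ρ ρbar : (Fin n → ℝ) → ℝ)
    (hu : ContDiff ℝ (⊤ : ℕ∞) u) (hz : ContDiff ℝ (⊤ : ℕ∞) z)
    (hc : ContDiff ℝ (⊤ : ℕ∞) (fun p : (Fin n → ℝ) × (Fin n → ℝ) => c p.1 p.2))
    (hT : ContDiff ℝ (⊤ : ℕ∞) T) (hρ : ContDiff ℝ (⊤ : ℕ∞) ρ) (hρbar : ContDiff ℝ (⊤ : ℕ∞) ρbar)
    (hρpos : ∀ x, 0 < ρ x) (hρbarpos : ∀ x, 0 < ρbar x)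
    -- `T` is the cost exponential of the (locally exact) 1-form `du`
    (contact : ∀ x i, pd i u x + cI c x (T x) i = 0)
    (hw : ∀ x, (wMat u c T x).PosDef)
    (hb : ∀ x, (bMat c x (T x)).PosDef)
    -- `θ` is constant: equivalently `log det w = log ρ − log(ρ̄∘T) + log det b` identically
    (htheta : ∀ x, Real.log (wMat u c T x).det
      = Real.log (ρ x) - Real.log (ρbar (T x)) + Real.log (bMat c x (T x)).det) :
    ∀ x, Lop u c T ρbar z x
      = lamF c T ρ ρbar x *
          laplaceBeltrami (fun y => lamF c T ρ ρbar y • wMat u c T y) z x := by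
  intro x
  -- smooth building blocks on the product
  set C : (Fin n → ℝ) × (Fin n → ℝ) → ℝ := fun p => c p.1 p.2 with hC
  set Ci : Fin n → (Fin n → ℝ) × (Fin n → ℝ) → ℝ := fun i p => fderiv ℝ C p (ee i, 0) with hCi
  have sCi : ∀ i, ContDiff ℝ (⊤ : ℕ∞) (Ci i) := fun i => smD8 hc _
  have ecI : ∀ y a i, cI c y a i = Ci i (y, a) := fun y a i => slot1 hc y a (ee i)
  set Bf : Fin n → Fin n → (Fin n → ℝ) × (Fin n → ℝ) → ℝ :=
    fun i s p => -(fderiv ℝ (Ci i) p (0, ee s)) with hBf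
  have sBf : ∀ i s, ContDiff ℝ (⊤ : ℕ∞) (Bf i s) := fun i s => (smD8 (sCi i) _).neg
  have eb : ∀ y a i s, bMat c y a i s = Bf i s (y, a) := by
    intro y a i s
    simp only [bMat, Matrix.of_apply, ecI]
    rw [slot2 (sCi i)]
  have spu : ∀ i, ContDiff ℝ (⊤ : ℕ∞) (fun y => pd i u y) := fun i => smD8 hu _
  have spz : ∀ i, ContDiff ℝ (⊤ : ℕ∞) (fun y => pd i z y) := fun i => smD8 hz _
  have ew : ∀ y i j, wMat u c T y i j =
      pd j (fun y => pd i u y) y + fderiv ℝ (Ci i) (y, T y) (ee j, 0) := by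
    intro y i j
    simp only [wMat, Matrix.of_apply, ecI]
    congr 1
    exact slot1 (sCi i) _ _ _
  have sgraph : ContDiff ℝ (⊤ : ℕ∞) (fun y => (y, T y)) := contDiff_id.prodMk hT
  have sw : ∀ i j, ContDiff ℝ (⊤ : ℕ∞) (fun y => wMat u c T y i j) := by
    intro i j
    simp only [ew]
    exact (smD8 (spu i) (ee j)).add ((smD8 (sCi i) (ee j, 0)).comp sgraph)
  have sb : ∀ i j, ContDiff ℝ (⊤ : ℕ∞) (fun y => bMat c y (T y) i j) := by
    intro i j
    simp only [eb]
    exact (sBf i j).comp sgraph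
  have dw : ∀ i j, DifferentiableAt ℝ (fun y => wMat u c T y i j) x :=
    fun i j => (sw i j).differentiable (by simp) x
  have dwb : ∀ i j, DifferentiableAt ℝ (fun y => bMat c y (T y) i j) x :=
    fun i j => (sb i j).differentiable (by simp) x
  have hwd : ∀ y, (wMat u c T y).det ≠ 0 := fun y => (hw y).det_pos.ne'
  have hbd : ∀ y, (bMat c y (T y)).det ≠ 0 := fun y => (hb y).det_pos.ne'
  have dwi := invdiff8 (wMat u c T) x dw (hwd x)
  -- third derivatives
  have symC : ∀ a b, (fun p => fderiv ℝ (Ci a) p (ee b, 0)) =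
      fun p => fderiv ℝ (Ci b) p (ee a, 0) := fun a b => by
    funext p; exact commD8 hc (ee a, 0) (ee b, 0) p
  have symu : ∀ a b, (fun y => pd b (fun y => pd a u y) y) =
      fun y => pd a (fun y => pd b u y) y := fun a b => by
    funext p; exact commD8 hu (ee a) (ee b) p
  have eβ : ∀ a b s, pd b (fun y => bMat c y (T x) a s) x =
      - fderiv ℝ (fun p => fderiv ℝ (Ci a) p (ee b, 0)) (x, T x) (0, ee s) := by
    intro a b s
    simp only [eb]
    rw [commD8 (sCi a)]
    have := slot1 (sBf a s) x (T x) (ee b)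
    simp only [pd]
    rw [this]
    simp only [hBf]
    rw [fderiv_fun_neg]; rfl
  have key := alg8 (wMat u c T x) (bMat c x (T x))
    (Matrix.of fun s j => fderiv ℝ (fun y => T y s) x (ee j))
    (fun j => Matrix.of fun a b => fderiv ℝ (fun y => wMat u c T y a b) x (ee j))
    (fun j => Matrix.of fun a b => fderiv ℝ (fun y => (wMat u c T y)⁻¹ a b) x (ee j))
    (fun a b j => pd j (fun y => pd b (fun y => pd a u y) y) x +
      fderiv ℝ (fun p => fderiv ℝ (Ci a) p (ee b, 0)) (x, T x) (ee j, 0))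
    (fun a b s => pd b (fun y => bMat c y (T x) a s) x)
    (fun l s p => fderiv ℝ (fun ybar => bMat c x ybar l s) (T x) (ee p))
    (fun j l s => fderiv ℝ (fun y => bMat c y (T y) l s) x (ee j))
    (fun s => fderiv ℝ (fun ybar => Real.log (ρbar ybar)) (T x) (ee s))
    (fun j => fderiv ℝ (fun y => Real.log (ρ y)) x (ee j))
    (by
      have := (hw x).inv.isHermitian
      simpa [Matrix.IsHermitian, Matrix.conjTranspose_eq_transpose_of_trivial] using this)
    (isUnit_iff_ne_zero.2 (hwd x)) (isUnit_iff_ne_zero.2 (hbd x))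
    (by
      ext i j
      rw [Matrix.mul_apply]
      simp only [Matrix.of_apply, eb, ew, hBf]
      have h0 : (fun y => pd i u y + Ci i (y, T y)) = fun _ => (0 : ℝ) := by
        funext y; rw [← ecI]; exact contact y i
      have h1 : fderiv ℝ (fun y => pd i u y + Ci i (y, T y)) x (ee j) =
          fderiv ℝ (fun _ => (0 : ℝ)) x (ee j) := by rw [h0]
      rw [fderiv_fun_add (f := fun y => pd i u y) (g := fun y => Ci i (y, T y)) ((spu i).differentiable (by simp) x)
        (((sCi i).comp sgraph).differentiable (by simp) x), add_apply,
        chain8 (sCi i) hT] at h1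
      simp only [fderiv_fun_const] at h1
      simp only [neg_mul, Finset.sum_neg_distrib]
      have h2 : (0 : (Fin n → ℝ) → (Fin n → ℝ) →L[ℝ] ℝ) x (ee j) = 0 := rfl
      rw [h2] at h1
      simp only [pd] at h1 ⊢
      linarith)
    (by
      intro a b j
      congr 1
      · exact commD8 (spu a) (ee b) (ee j) x
      · exact commD8 (sCi a) _ _ _)
    (by
      intro a b j
      simp only [symC a b, symu a b])
    (by
      intro a b s
      rw [eβ, eβ, symC a b])
    (by
      intro j a b
      simp only [Matrix.of_apply, eβ, ew]
      rw [fderiv_fun_add (f := fun y => pd b (fun y => pd a u y) y)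
        (g := fun y => fderiv ℝ (Ci a) (y, T y) (ee b, 0)) ((smD8 (spu a) (ee b)).differentiable (by simp) x)
        (((smD8 (sCi a) (ee b, 0)).comp sgraph).differentiable (by simp) x), add_apply,
        chain8 (smD8 (sCi a) (ee b, 0)) hT]
      simp only [neg_mul, Finset.sum_neg_distrib, pd]
      ring)
    (fun j => invder8 (wMat u c T) x (ee j) dw hwd)
    (by
      intro j l s
      simp only [eb, Matrix.of_apply]
      rw [chain8 (sBf l s) hT]
      congr 1
      · exact (slot1 (sBf l s) _ _ _).symm
      · refine Finset.sum_congr rfl fun p _ => ?_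
        rw [slot2 (sBf l s)])
    (by
      intro j
      have hr0 : (fun y => Real.log (ρ y)) = fun y =>
          Real.log (wMat u c T y).det - Real.log (bMat c y (T y)).det + Real.log (ρbar (T y)) := by
        funext y; rw [htheta y]; ring
      have slr : ContDiff ℝ (⊤ : ℕ∞) (fun y => Real.log (ρbar y)) :=
        hρbar.log fun y => (hρbarpos y).ne'
      have slr2 : ContDiff ℝ (⊤ : ℕ∞)
          (fun p : (Fin n → ℝ) × (Fin n → ℝ) => Real.log (ρbar p.2)) := slr.comp contDiff_snd
      obtain ⟨a1, a2⟩ := logdet8 (wMat u c T) x (ee j) dw (hwd x)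
      obtain ⟨b1, b2⟩ := logdet8 (fun y => bMat c y (T y)) x (ee j) dwb (hbd x)
      have r1 := chain8 slr2 hT x (ee j)
      simp only at r1
      rw [← slot1 slr2] at r1
      simp_rw [← slot2 slr2] at r1
      rw [hr0, fderiv_fun_add (f := fun y => Real.log (wMat u c T y).det -
        Real.log (bMat c y (T y)).det) (g := fun y => Real.log (ρbar (T y))) (a1.sub b1) ((slr.comp hT).differentiable (by simp) x), add_apply,
        fderiv_fun_sub a1 b1, sub_apply, a2, b2, r1]
      simp)
  -- the conformal factor
  have hlam := fun y => lam8 hn (hρpos y) (hρbarpos (T y)) (hb y).det_pos (hw y).det_pos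
    (lam := lamF c T ρ ρbar y) rfl (htheta y)
  have hsq : ∀ y, Real.sqrt (lamF c T ρ ρbar y • wMat u c T y).det = lamF c T ρ ρbar y * ρ y := by
    intro y
    rw [Matrix.det_smul, Fintype.card_fin]; exact (hlam y).2
  have hinv : ∀ y i j, (lamF c T ρ ρbar y • wMat u c T y)⁻¹ i j =
      (lamF c T ρ ρbar y)⁻¹ * (wMat u c T y)⁻¹ i j := by
    intro y i j
    have hl0 := (hlam y).1.ne'
    have : (lamF c T ρ ρbar y • wMat u c T y)⁻¹ = (lamF c T ρ ρbar y)⁻¹ • (wMat u c T y)⁻¹ := by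
      apply Matrix.inv_eq_right_inv
      rw [Matrix.smul_mul, Matrix.mul_smul, smul_smul, mul_inv_cancel₀ hl0, one_smul,
        Matrix.mul_nonsing_inv _ (isUnit_iff_ne_zero.2 (hwd y))]
    rw [this]; simp
  have hfun : ∀ j, (fun y => Real.sqrt (lamF c T ρ ρbar y • wMat u c T y).det *
      ∑ i, (lamF c T ρ ρbar y • wMat u c T y)⁻¹ i j * pd i z y) =
      fun y => ρ y * ∑ i, (wMat u c T y)⁻¹ i j * pd i z y := by
    intro j; funext y
    have hl0 := (hlam y).1.ne'
    rw [hsq]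
    simp_rw [hinv, mul_assoc]
    rw [← Finset.mul_sum]
    field_simp
  have hρd : DifferentiableAt ℝ ρ x := hρ.differentiable (by simp) x
  have hder : ∀ j, pd j (fun y => ρ y * ∑ i, (wMat u c T y)⁻¹ i j * pd i z y) x =
      ρ x * ∑ i, ((wMat u c T x)⁻¹ i j * pd j (fun y => pd i z y) x +
        (fderiv ℝ (fun y => (wMat u c T y)⁻¹ i j) x (ee j) +
          fderiv ℝ (fun y => Real.log (ρ y)) x (ee j) * (wMat u c T x)⁻¹ i j) * pd i z x) := by
    intro j
    have h1 : HasFDerivAt (fun y => ∑ i, (wMat u c T y)⁻¹ i j * pd i z y) _ x :=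
      HasFDerivAt.fun_sum fun i _ => (dwi i j).hasFDerivAt.mul
        ((spz i).differentiable (by simp) x).hasFDerivAt
    have h2 : HasFDerivAt (fun y => ρ y * ∑ i, (wMat u c T y)⁻¹ i j * pd i z y) _ x :=
      hρd.hasFDerivAt.mul h1
    rw [fderiv.log hρd (hρpos x).ne']
    unfold pd at h2 ⊢
    rw [h2.fderiv]
    have := (hρpos x).ne'
    simp only [add_apply, smul_apply, sum_apply, smul_eq_mul, Finset.mul_sum, Finset.sum_mul,
      ← Finset.sum_add_distrib]
    refine Finset.sum_congr rfl fun i _ => ?_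
    field_simp
    ring
  have hρ0 := (hρpos x).ne'
  have hl0 := (hlam x).1.ne'
  have hR : lamF c T ρ ρbar x *
      laplaceBeltrami (fun y => lamF c T ρ ρbar y • wMat u c T y) z x =
      ∑ i, ∑ j, (wMat u c T x)⁻¹ i j * pd j (fun y => pd i z y) x +
      ∑ i, (∑ j, (fderiv ℝ (fun y => (wMat u c T y)⁻¹ i j) x (ee j) +
          fderiv ℝ (fun y => Real.log (ρ y)) x (ee j) * (wMat u c T x)⁻¹ i j)) * pd i z x := by
    unfold laplaceBeltrami
    simp only [hfun, hder]
    rw [hsq]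
    rw [← Finset.mul_sum, Finset.sum_comm, ← Finset.sum_add_distrib]
    simp_rw [Finset.sum_mul, ← Finset.sum_add_distrib]
    field_simp
  rw [hR]
  simp only [Matrix.of_apply] at key
  simp_rw [key]
  unfold Lop
  have q1 : ∀ f : Fin n → Fin n → Fin n → Fin n → ℝ, ∑ i, ∑ j, ∑ s, ∑ k, f i j s k =
      ∑ k, ∑ i, ∑ j, ∑ s, f i j s k := by
    intro f
    conv_rhs => rw [Finset.sum_comm]
    refine Finset.sum_congr rfl fun i _ => ?_
    conv_rhs => rw [Finset.sum_comm]
    refine Finset.sum_congr rfl fun j _ => ?_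
    rw [Finset.sum_comm]
  rw [q1 (fun i j s k => ((wMat u c T x)⁻¹ i j)
      * pd j (fun y => bMat c y (T x) i s) x
      * ((bMat c x (T x))⁻¹ s k) * pd k z x),
    q1 (fun s i p k => ((bMat c x (T x))⁻¹ s i)
      * fderiv ℝ (fun ybar => bMat c x ybar i s) (T x) (ee p)
      * ((bMat c x (T x))⁻¹ p k) * pd k z x), Finset.sum_comm (f := fun s k => fderiv ℝ (fun ybar => Real.log (ρbar ybar)) (T x) (ee s)
      * ((bMat c x (T x))⁻¹ s k) * pd k z x)]
  simp_rw [add_mul, sub_mul, neg_mul, Finset.sum_add_distrib, Finset.sum_sub_distrib,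
    Finset.sum_neg_distrib, Finset.sum_mul]
  ring
end
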